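/- Let R ⊆ {0,1}^k be a symmetric Boolean relation. If R is not balanced, then the relation 2-OR is cone-definable from R. -/

import Mathlib

/-- The integer value of a Boolean. -/
def bInt (b : Bool) : ℤ := if b then 1 else 0

/-- The partial Boolean operation determined by integer coefficients `α`:
it is defined on a tuple `x` exactly when `∑ i, α i * x i ∈ {0,1}`,
and then returns that sum (as a Boolean). -/
def coeffOp {m : ℕ} (α : Fin m → ℤ) : (Fin m → Bool) → Option Bool :=
  fun x =>
    if (∑ i, α i * bInt (x i)) = 1 then some true
    else if (∑ i, α i * bInt (x i)) = 0 then some false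
    else none

/-- A partial Boolean operation is balanced if it is given by integer coefficients
summing to `1`, as in `coeffOp`. -/
def IsBalancedOp {m : ℕ} (f : (Fin m → Bool) → Option Bool) : Prop :=
  ∃ α : Fin m → ℤ, (∑ i, α i) = 1 ∧ f = coeffOp α

/-- A Boolean relation `R` of arity `n` is preserved by a partial Boolean operation `f`
of arity `m` if, applying `f` coordinatewise to any `m` tuples of `R`, whenever the
result is defined in every coordinate, the resulting tuple lies in `R`. -/
def Preserves {m n : ℕ} (f : (Fin m → Bool) → Option Bool)
    (R : Set (Fin n → Bool)) : Prop :=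
  ∀ t : Fin m → (Fin n → Bool), (∀ i, t i ∈ R) →
    ∀ w : Fin n → Bool, (∀ j, f (fun i => t i j) = some (w j)) → w ∈ R

/-- A Boolean relation is balanced if it is preserved by every balanced operation. -/
def IsBalancedRel {n : ℕ} (R : Set (Fin n → Bool)) : Prop :=
  ∀ (m : ℕ) (f : (Fin m → Bool) → Option Bool), IsBalancedOp f → Preserves f R

/-- An entry of a cone-definition tuple: a constant `0`/`1`, a variable `x i`,
or a negated variable `¬ x i`. -/
inductive ConeEntry (m : ℕ) where
  | const : Bool → ConeEntry m
  | pos : Fin m → ConeEntry m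
  | neg : Fin m → ConeEntry m

/-- Evaluate a cone entry under an assignment `f` to the variables. -/
def ConeEntry.eval {m : ℕ} (f : Fin m → Bool) : ConeEntry m → Bool
  | .const b => b
  | .pos i => f i
  | .neg i => !(f i)

/-- A Boolean relation `T` of arity `m` is cone-definable from a Boolean relation `U` of
arity `n` if there is a tuple `(y_1, …, y_n)` of constants, variables and negated
variables, in which every variable `x_1, …, x_m` occurs, such that for every assignment
`f` we have `(f x_1, …, f x_m) ∈ T` iff the evaluation of `(y_1, …, y_n)` lies in `U`. -/
def ConeDefinable {m n : ℕ} (T : Set (Fin m → Bool)) (U : Set (Fin n → Bool)) : Prop :=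
  ∃ y : Fin n → ConeEntry m,
    (∀ i : Fin m, ∃ j : Fin n, y j = ConeEntry.pos i ∨ y j = ConeEntry.neg i) ∧
    (∀ f : Fin m → Bool, f ∈ T ↔ (fun j => (y j).eval f) ∈ U)

/-- The `k`-ary OR relation: all tuples except the all-zeros tuple. -/
def kOR (k : ℕ) : Set (Fin k → Bool) := {x | ∃ i, x i = true}

/-- The weight (number of `1` entries) of a Boolean tuple. -/
def wt {k : ℕ} (x : Fin k → Bool) : ℕ := ∑ i, if x i then 1 else 0

theorem wt_le {k : ℕ} (x : Fin k → Bool) : wt x ≤ k := by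
  calc wt x ≤ ∑ _i : Fin k, 1 := Finset.sum_le_sum fun i _ => by split_ifs <;> simp
    _ = k := by simp

theorem wt_cast_eq_sum_bInt {k : ℕ} (x : Fin k → Bool) : (wt x : ℤ) = ∑ j, bInt (x j) := by
  simp [wt, bInt]

theorem coeffOp_eq_some {m : ℕ} {α : Fin m → ℤ} {x : Fin m → Bool} {b : Bool}
    (h : coeffOp α x = some b) : ∑ i, α i * bInt (x i) = bInt b := by
  unfold coeffOp at h
  split_ifs at h with h₁ h₂
  · cases h; simpa [bInt] using h₁
  · cases h; simpa [bInt] using h₂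

/-- A set of integers in `[0, k]` closed under `a + b - c` (within `[0, k]`) is the
intersection of `[0, k]` with a coset of a subgroup of `ℤ`. -/
theorem exists_progression_of_closed {k : ℤ} {S : Set ℤ} (hne : S.Nonempty)
    (hS : ∀ n ∈ S, 0 ≤ n ∧ n ≤ k)
    (hcl : ∀ a ∈ S, ∀ b ∈ S, ∀ c ∈ S, 0 ≤ a + b - c → a + b - c ≤ k → a + b - c ∈ S) :
    ∃ a d : ℤ, (∀ s ∈ S, d ∣ s - a) ∧ ∀ u, 0 ≤ u → u ≤ k → d ∣ u - a → u ∈ S := by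
  classical
  obtain ⟨s₀, hs₀⟩ := hne
  by_cases hsub : ∀ s ∈ S, s = s₀
  · refine ⟨s₀, 0, fun s hs => by simp [hsub s hs], fun u _ _ hu => ?_⟩
    rw [zero_dvd_iff, sub_eq_zero] at hu
    exact hu ▸ hs₀
  push Not at hsub
  obtain ⟨s₁, hs₁, hne⟩ := hsub
  have hgap : ∃ d : ℕ, 0 < d ∧ ∃ a ∈ S, a + d ∈ S := by
    rcases lt_or_gt_of_ne hne with h | h
    · exact ⟨(s₀ - s₁).toNat, by omega, s₁, hs₁, by
        rwa [show s₁ + ((s₀ - s₁).toNat : ℤ) = s₀ by omega]⟩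
    · exact ⟨(s₁ - s₀).toNat, by omega, s₀, hs₀, by
        rwa [show s₀ + ((s₁ - s₀).toNat : ℤ) = s₁ by omega]⟩
  obtain ⟨hd, a, ha, had⟩ := Nat.find_spec hgap
  have hmin : ∀ x ∈ S, ∀ y ∈ S, x < y → (Nat.find hgap : ℤ) ≤ y - x := by
    intro x hx y hy hxy
    have := Nat.find_min' hgap (m := (y - x).toNat)
      ⟨by omega, x, hx, by rwa [show x + ((y - x).toNat : ℤ) = y by omega]⟩
    omega
  generalize Nat.find hgap = d at *
  have hup : ∀ j : ℕ, a + d * j ≤ k → a + d * j ∈ S := by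
    intro j
    induction j with
    | zero => intro _; simpa using ha
    | succ j ih =>
      intro hj
      push_cast at hj ⊢
      have h₀ := hS a ha
      have hp : (0 : ℤ) ≤ d * j := by positivity
      have := hcl _ (ih (by linarith)) _ had _ ha (by linarith) (by linarith)
      convert this using 1; ring
  have hdown : ∀ j : ℕ, 0 ≤ a - d * j → a - d * j ∈ S := by
    intro j
    induction j with
    | zero => intro _; simpa using ha
    | succ j ih =>
      intro hj
      push_cast at hj ⊢
      have h₀ := hS a ha
      have hp : (0 : ℤ) ≤ d * j := by positivity
      have := hcl _ (ih (by linarith)) _ ha _ had (by linarith) (by linarith)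
      convert this using 1; ring
  have hall : ∀ u, 0 ≤ u → u ≤ k → (d : ℤ) ∣ u - a → u ∈ S := by
    rintro u hu₀ huk ⟨j, hj⟩
    obtain ⟨n, rfl | rfl⟩ := j.eq_nat_or_neg
    · have h : u = a + d * n := by linarith
      rw [h] at huk ⊢
      exact hup n huk
    · have h : u = a - d * n := by linarith
      rw [h] at hu₀ ⊢
      exact hdown n hu₀
  refine ⟨a, d, fun s hs => ?_, hall⟩
  have hd' : (0 : ℤ) < d := by exact_mod_cast hd
  have hr₀ := Int.emod_nonneg (s - a) hd'.ne'
  have hrd := Int.emod_lt_of_pos (s - a) hd'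
  have hdvd : (d : ℤ) ∣ (s - (s - a) % d) - a := by
    rw [sub_right_comm]
    exact Int.dvd_self_sub_emod
  rw [Int.dvd_iff_emod_eq_zero]
  by_contra hr
  obtain ⟨hs0, hsk⟩ := hS s hs
  obtain ⟨ha0, hak⟩ := hS a ha
  obtain ⟨had0, hadk⟩ := hS _ had
  generalize (s - a) % (d : ℤ) = r at *
  by_cases hlow : 0 ≤ s - r
  · have := hmin _ (hall (s - r) hlow (by omega) hdvd) s hs (by omega)
    omega
  · have hdvd' : (d : ℤ) ∣ (s - r + d) - a := by
      rw [add_sub_right_comm]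
      exact dvd_add hdvd dvd_rfl
    have := hmin s hs _ (hall (s - r + d) (by omega) (by omega) hdvd') (by omega)
    omega

/-- The tuple with `P` entries `e₁`, then `Q` entries `e₂`, then `C` ones, then zeros. -/
def blockEntry {m : ℕ} (P Q C : ℕ) (e₁ e₂ : ConeEntry m) (j : ℕ) : ConeEntry m :=
  if j < P then e₁ else if j < P + Q then e₂ else .const (decide (j < P + Q + C))

theorem wt_blockEntry {m k P Q C : ℕ} (h : P + Q + C ≤ k) (e₁ e₂ : ConeEntry m)
    (f : Fin m → Bool) :
    (wt (fun j : Fin k => (blockEntry P Q C e₁ e₂ j).eval f) : ℤ) =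
      P * bInt (e₁.eval f) + Q * bInt (e₂.eval f) + C := by
  have key : ∀ n : ℕ,
      (∑ j ∈ Finset.range n, if (blockEntry P Q C e₁ e₂ j).eval f then 1 else 0 : ℕ) =
        min n P * (if e₁.eval f then 1 else 0) +
          (min n (P + Q) - min n P) * (if e₂.eval f then 1 else 0) +
          (min n (P + Q + C) - min n (P + Q)) := by
    intro n
    induction n with
    | zero => simp
    | succ n ih =>
      rw [Finset.sum_range_succ, ih, blockEntry]
      by_cases h₁ : n < P
      · rw [if_pos h₁]
        split_ifs <;> omega
      · rw [if_neg h₁]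
        by_cases h₂ : n < P + Q
        · rw [if_pos h₂]
          split_ifs <;> omega
        · rw [if_neg h₂]
          rw [show (ConeEntry.const (decide (n < P + Q + C))).eval f =
            decide (n < P + Q + C) from rfl]
          simp only [decide_eq_true_eq]
          split_ifs <;> omega
  have hw := Fin.sum_univ_eq_sum_range
    (fun j => if (blockEntry P Q C e₁ e₂ j).eval f then 1 else 0) k
  rw [key k] at hw
  rw [show wt (fun j : Fin k => (blockEntry P Q C e₁ e₂ j).eval f) = _ from hw]
  rw [min_eq_right (by omega), min_eq_right (by omega), min_eq_right (by omega)]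
  simp [bInt]

/-- The literal of the variable `i` with the sign of `p`. -/
def signedLit {m : ℕ} (p : ℤ) (i : Fin m) : ConeEntry m := if 0 < p then .pos i else .neg i

theorem natAbs_mul_signedLit {m : ℕ} (p : ℤ) (i : Fin m) (f : Fin m → Bool) :
    p.natAbs * bInt ((signedLit p i).eval f) = p * bInt (f i) + max 0 (-p) := by
  unfold signedLit
  split_ifs <;> cases h : f i <;> simp [ConeEntry.eval, bInt, h, abs_eq_max_neg] <;> omega

/-- Weights `a`, `b`, `c` of a symmetric relation such that `a + b - c` is not
one of its weights give a cone-definition of `2`-OR. -/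
theorem coneDefinable_twoOR_of_weights {k : ℕ} {R : Set (Fin k → Bool)} {S : Set ℤ}
    (hRS : ∀ x, x ∈ R ↔ (wt x : ℤ) ∈ S) (hS : ∀ n ∈ S, 0 ≤ n ∧ n ≤ k) {a b c : ℤ}
    (ha : a ∈ S) (hb : b ∈ S) (hc : c ∈ S) (h₀ : 0 ≤ a + b - c) (hk : a + b - c ≤ k)
    (hd : a + b - c ∉ S) : ConeDefinable (kOR 2) R := by
  obtain ⟨p, hp⟩ : ∃ p, p = c - b := ⟨_, rfl⟩
  obtain ⟨q, hq⟩ : ∃ q, q = c - a := ⟨_, rfl⟩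
  have hp₀ : p ≠ 0 := by
    rintro rfl
    exact hd (by rwa [show a + b - c = a by omega])
  have hq₀ : q ≠ 0 := by
    rintro rfl
    exact hd (by rwa [show a + b - c = b by omega])
  have hSa := hS a ha
  have hSb := hS b hb
  have hSc := hS c hc
  obtain ⟨C, hC⟩ : ∃ C : ℕ, (C : ℤ) = a + b - c - max 0 (-p) - max 0 (-q) :=
    ⟨(a + b - c - max 0 (-p) - max 0 (-q)).toNat, by omega⟩
  have hle : p.natAbs + q.natAbs + C ≤ k := by omega
  refine ⟨fun j => blockEntry p.natAbs q.natAbs C (signedLit p 0) (signedLit q 1) j, ?_, ?_⟩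
  · have hlit : ∀ (r : ℤ) (i : Fin 2), signedLit r i = .pos i ∨ signedLit r i = .neg i := by
      intro r i
      unfold signedLit
      split_ifs <;> simp
    rw [Fin.forall_fin_two]
    constructor
    · refine ⟨⟨0, by omega⟩, ?_⟩
      have h : 0 < p.natAbs := by omega
      simpa [blockEntry, h] using hlit p 0
    · refine ⟨⟨p.natAbs, by omega⟩, ?_⟩
      have h : 0 < q.natAbs := by omega
      simpa [blockEntry, h] using hlit q 1
  · intro f
    rw [hRS, wt_blockEntry hle, natAbs_mul_signedLit, natAbs_mul_signedLit,
      show p * bInt (f 0) + max 0 (-p) + (q * bInt (f 1) + max 0 (-q)) + C =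
        a + b - c + p * bInt (f 0) + q * bInt (f 1) by rw [hC]; ring, hp, hq]
    cases h₁ : f 0 <;> cases h₂ : f 1 <;> simp [kOR, Fin.exists_fin_two, bInt, *]

/-- Let `R ⊆ {0,1}^k` be a symmetric Boolean relation (membership depends only on the
weight of a tuple). If `R` is not balanced, then `2`-OR is cone-definable from `R`. -/
theorem symmetric_not_balanced_coneDefines_twoOR {k : ℕ} (R : Set (Fin k → Bool))
    (hsym : ∀ x y : Fin k → Bool, wt x = wt y → (x ∈ R ↔ y ∈ R))
    (hR : ¬ IsBalancedRel R) :
    ConeDefinable (kOR 2) R := by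
  set S : Set ℤ := {n | ∃ x ∈ R, (wt x : ℤ) = n}
  have hRS : ∀ x, x ∈ R ↔ (wt x : ℤ) ∈ S := fun x =>
    ⟨fun hx => ⟨x, hx, rfl⟩, fun ⟨y, hy, h⟩ => (hsym y x (by exact_mod_cast h)).1 hy⟩
  have hS : ∀ n ∈ S, 0 ≤ n ∧ n ≤ (k : ℤ) := by
    rintro n ⟨x, -, rfl⟩
    exact ⟨by positivity, by exact_mod_cast wt_le x⟩
  by_contra hcone
  refine hR ?_
  rintro m f ⟨α, hα, rfl⟩ t ht w hw
  have hne : S.Nonempty := by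
    rcases Nat.eq_zero_or_pos m with rfl | hm
    · simp at hα
    · exact ⟨_, t ⟨0, hm⟩, ht _, rfl⟩
  obtain ⟨a, d, hdvd, hmem⟩ := exists_progression_of_closed hne hS
    fun a ha b hb c hc h₀ hk => by
      by_contra hd
      exact hcone (coneDefinable_twoOR_of_weights hRS hS ha hb hc h₀ hk hd)
  rw [hRS]
  refine hmem _ (by positivity) (by exact_mod_cast wt_le w) ?_
  have hsum : (wt w : ℤ) - a = ∑ i, α i * ((wt (t i) : ℤ) - a) := by
    simp only [mul_sub, Finset.sum_sub_distrib, ← Finset.sum_mul, hα, one_mul,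
      wt_cast_eq_sum_bInt, Finset.mul_sum]
    rw [Finset.sum_comm]
    simp only [coeffOp_eq_some (hw _)]
  rw [hsum]
  exact Finset.dvd_sum fun i _ => (hdvd _ ((hRS _).1 (ht i))).mul_left _
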